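/- Let A be a smooth, rapidly decaying solution of the short-pulse equation with decaying antiderivatives up to order 3, and set B := ∂_ξ^{-3}A + ∂_ξ^{-1}(A³). Then B satisfies the inhomogeneous linear short-pulse equation B_{ξτ} = B + 3A² ∂_ξ^{-1}A + 9A⁴ A_ξ. -/

import Mathlib

open MeasureTheory Set Filter

/-- Fundamental theorem of calculus for left half-line integrals. -/
lemma hasDerivAt_Iic_aux (g : ℝ → ℝ) (hg : Continuous g)
    (hi : ∀ x : ℝ, IntegrableOn g (Iic x) (volume : Measure ℝ)) (x : ℝ) :
    HasDerivAt (fun u : ℝ => ∫ y in Iic u, g y) (g x) x := by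
  have h1 : (fun u : ℝ => ∫ y in Iic u, g y)
      = fun u : ℝ => (∫ y in Iic x, g y) + ∫ y in x..u, g y := by
    funext u
    have := intervalIntegral.integral_Iic_sub_Iic (hi x) (hi u)
    linarith
  rw [h1]
  exact (intervalIntegral.integral_hasDerivAt_right (hg.intervalIntegrable _ _)
    (hg.stronglyMeasurableAtFilter _ _) hg.continuousAt).const_add _

lemma hasDerivAt_fst_aux (F : ℝ × ℝ → ℝ) (hF : Differentiable ℝ F) (t x : ℝ) :
    HasDerivAt (fun s : ℝ => F (s, x)) (fderiv ℝ F (t, x) (1, 0)) t :=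
  (hF (t, x)).hasFDerivAt.comp_hasDerivAt t ((hasDerivAt_id t).prodMk (hasDerivAt_const t x))

lemma hasDerivAt_snd_aux (F : ℝ × ℝ → ℝ) (hF : Differentiable ℝ F) (t x : ℝ) :
    HasDerivAt (fun s : ℝ => F (t, s)) (fderiv ℝ F (t, x) (0, 1)) x :=
  (hF (t, x)).hasFDerivAt.comp_hasDerivAt x ((hasDerivAt_const x t).prodMk (hasDerivAt_id x))

lemma contDiff_dir_aux (F : ℝ × ℝ → ℝ) (hF : ContDiff ℝ (⊤ : ℕ∞) F) (v : ℝ × ℝ) :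
    ContDiff ℝ (⊤ : ℕ∞) (fun p => fderiv ℝ F p v) :=
  (hF.fderiv_right (m := ((⊤ : ℕ∞) : WithTop ℕ∞)) (by simp)).clm_apply contDiff_const

lemma mixed_aux (F : ℝ × ℝ → ℝ) (hF : ContDiff ℝ (⊤ : ℕ∞) F) (p v w : ℝ × ℝ) :
    fderiv ℝ (fun q => fderiv ℝ F q v) p w = fderiv ℝ (fun q => fderiv ℝ F q w) p v := by
  have hd : DifferentiableAt ℝ (fderiv ℝ F) p :=
    ((hF.fderiv_right (m := ((⊤ : ℕ∞) : WithTop ℕ∞)) (by simp)).differentiable (by simp)) p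
  have hs : IsSymmSndFDerivAt ℝ F p :=
    hF.contDiffAt.isSymmSndFDerivAt (by simp; exact WithTop.coe_le_coe.2 (le_top : (2 : ℕ∞) ≤ ⊤))
  have key : ∀ a b : ℝ × ℝ, fderiv ℝ (fun q => fderiv ℝ F q a) p b
      = fderiv ℝ (fderiv ℝ F) p b a := by
    intro a b
    rw [fderiv_clm_apply hd (differentiableAt_const a)]
    simp
  rw [key, key]
  exact hs w v

/-- For a smooth, rapidly decaying solution `A` of the short-pulse equation with
decaying antiderivatives up to order 3, the function
`B := ∂_ξ^{-3}A + ∂_ξ^{-1}(A³)` satisfies the inhomogeneous linear short-pulse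
equation `B_{ξτ} = B + 3A² ∂_ξ^{-1}A + 9A⁴ A_ξ`. -/
theorem shortPulse_third_antiderivative_equation
    (A : ℝ → ℝ → ℝ) (hA : ContDiff ℝ (⊤ : ℕ∞) (Function.uncurry A))
    (hInt : ∀ (τ ξ : ℝ), IntegrableOn (A τ) (Iic ξ) (volume : Measure ℝ))
    (hInt2 : ∀ (τ ξ : ℝ),
      IntegrableOn (fun x : ℝ => ∫ y in Iic x, A τ y) (Iic ξ) (volume : Measure ℝ))
    (hInt3 : ∀ (τ ξ : ℝ),
      IntegrableOn (fun x : ℝ => ∫ y in Iic x, ∫ z in Iic y, A τ z) (Iic ξ)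
        (volume : Measure ℝ))
    (hInt4 : ∀ (τ ξ : ℝ),
      IntegrableOn (fun x : ℝ => (A τ x) ^ 3) (Iic ξ) (volume : Measure ℝ))
    (hPDE : ∀ τ ξ : ℝ,
      deriv (fun x : ℝ => deriv (fun t : ℝ => A t x) τ) ξ
        = A τ ξ + iteratedDeriv 2 (fun x : ℝ => (A τ x) ^ 3) ξ)
    (hFirst : ∀ τ ξ : ℝ,
      deriv (fun t : ℝ => A t ξ) τ
        = (∫ x in Iic ξ, A τ x) + deriv (fun x : ℝ => (A τ x) ^ 3) ξ)
    (hdecayA : ∀ τ : ℝ, Tendsto (A τ) atBot (nhds 0))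
    (hswap1 : ∀ τ ξ : ℝ,
      deriv (fun t : ℝ => ∫ x in Iic ξ, A t x) τ
        = ∫ x in Iic ξ, deriv (fun t : ℝ => A t x) τ)
    (hswap2 : ∀ τ ξ : ℝ,
      deriv (fun t : ℝ => ∫ x in Iic ξ, (A t x) ^ 3) τ
        = ∫ x in Iic ξ, deriv (fun t : ℝ => (A t x) ^ 3) τ)
    (hswap3 : ∀ τ ξ : ℝ,
      deriv (fun t : ℝ => ∫ x in Iic ξ, ∫ y in Iic x, A t y) τ
        = ∫ x in Iic ξ, deriv (fun t : ℝ => ∫ y in Iic x, A t y) τ) :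
    ∀ τ ξ : ℝ,
      deriv (fun t : ℝ =>
          deriv (fun x : ℝ =>
            (∫ a in Iic x, ∫ b in Iic a, ∫ c in Iic b, A t c)
              + ∫ a in Iic x, (A t a) ^ 3) ξ) τ
        = ((∫ a in Iic ξ, ∫ b in Iic a, ∫ c in Iic b, A τ c)
            + ∫ a in Iic ξ, (A τ a) ^ 3)
          + 3 * (A τ ξ) ^ 2 * (∫ x in Iic ξ, A τ x)
          + 9 * (A τ ξ) ^ 4 * deriv (fun x : ℝ => A τ x) ξ := by
  have hAd : Differentiable ℝ (Function.uncurry A) := hA.differentiable (by simp)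
  have hC : ContDiff ℝ (⊤ : ℕ∞) (fun p : ℝ × ℝ => (Function.uncurry A p) ^ 3) := hA.pow 3
  have hCd : Differentiable ℝ (fun p : ℝ × ℝ => (Function.uncurry A p) ^ 3) :=
    hC.differentiable (by simp)
  have hAc : ∀ τ, Continuous (A τ) := fun τ =>
    hA.continuous.comp (continuous_const.prodMk continuous_id)
  have hCc : ∀ τ, Continuous (fun x => (A τ x) ^ 3) := fun τ => (hAc τ).pow 3
  -- the antiderivatives
  set I1 : ℝ → ℝ → ℝ := fun t x => ∫ y in Iic x, A t y with hI1
  set I2 : ℝ → ℝ → ℝ := fun t x => ∫ y in Iic x, I1 t y with hI2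
  have hI1x : ∀ t x, HasDerivAt (I1 t) (A t x) x := fun t x =>
    hasDerivAt_Iic_aux (A t) (hAc t) (hInt t) x
  have hI1c : ∀ t, Continuous (I1 t) := fun t =>
    continuous_iff_continuousAt.2 fun x => (hI1x t x).continuousAt
  have hI2x : ∀ t x, HasDerivAt (I2 t) (I1 t x) x := fun t x =>
    hasDerivAt_Iic_aux (I1 t) (hI1c t) (hInt2 t) x
  have hI2c : ∀ t, Continuous (I2 t) := fun t =>
    continuous_iff_continuousAt.2 fun x => (hI2x t x).continuousAt
  have hI3x : ∀ t x, HasDerivAt (fun x => ∫ y in Iic x, I2 t y) (I2 t x) x := fun t x =>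
    hasDerivAt_Iic_aux (I2 t) (hI2c t) (hInt3 t) x
  have hI4x : ∀ t x, HasDerivAt (fun x => ∫ y in Iic x, (A t y) ^ 3) ((A t x) ^ 3) x := fun t x =>
    hasDerivAt_Iic_aux (fun y => (A t y) ^ 3) (hCc t) (hInt4 t) x
  -- partial derivatives of `A` and its cube
  have hAt : ∀ t x, HasDerivAt (fun s => A s x)
      (fderiv ℝ (Function.uncurry A) (t, x) (1, 0)) t := fun t x =>
    hasDerivAt_fst_aux _ hAd t x
  have hAx : ∀ t x, HasDerivAt (fun s => A t s)
      (fderiv ℝ (Function.uncurry A) (t, x) (0, 1)) x := fun t x =>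
    hasDerivAt_snd_aux _ hAd t x
  have hCx : ∀ t x, HasDerivAt (fun s => (A t s) ^ 3)
      (fderiv ℝ (fun p : ℝ × ℝ => (Function.uncurry A p) ^ 3) (t, x) (0, 1)) x := fun t x =>
    hasDerivAt_snd_aux _ hCd t x
  -- `I1` is jointly smooth
  have hI1s : ContDiff ℝ (⊤ : ℕ∞) (Function.uncurry I1) := by
    have : Function.uncurry I1 = fun p : ℝ × ℝ => fderiv ℝ (Function.uncurry A) p (1, 0)
        - fderiv ℝ (fun p : ℝ × ℝ => (Function.uncurry A p) ^ 3) p (0, 1) := by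
      funext ⟨t, x⟩
      have h := hFirst t x
      rw [(hAt t x).deriv, (hCx t x).deriv] at h
      change I1 t x = _
      change _ = I1 t x + _ at h
      linarith
    rw [this]
    exact (contDiff_dir_aux _ hA _).sub (contDiff_dir_aux _ hC _)
  have hI1d : Differentiable ℝ (Function.uncurry I1) := hI1s.differentiable (by simp)
  have hI1t : ∀ t x, HasDerivAt (fun s => I1 s x)
      (fderiv ℝ (Function.uncurry I1) (t, x) (1, 0)) t := fun t x =>
    hasDerivAt_fst_aux _ hI1d t x
  -- mixed partials of `I1`
  have hmix : ∀ t x, HasDerivAt (fun y => fderiv ℝ (Function.uncurry I1) (t, y) (1, 0))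
      (deriv (fun s => A s x) t) x := by
    intro t x
    have h := hasDerivAt_snd_aux _
      ((contDiff_dir_aux _ hI1s (1, 0)).differentiable (by simp)) t x
    rw [mixed_aux _ hI1s] at h
    have e : (fun q => fderiv ℝ (Function.uncurry I1) q (0, 1)) = Function.uncurry A := by
      funext ⟨s, y⟩
      exact (hasDerivAt_snd_aux _ hI1d s y).unique (hI1x s y)
    rw [e] at h
    rw [(hAt t x).deriv]
    exact h
  -- the derivative of the cube is integrable on half-lines
  have hCi : ∀ t x, IntegrableOn (fun y => deriv (fun z => (A t z) ^ 3) y) (Iic x) volume := by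
    intro t
    by_contra hcon
    push Not at hcon
    obtain ⟨x0, hx0⟩ := hcon
    have hcont : Continuous (fun y => deriv (fun z => (A t z) ^ 3) y) := by
      have : (fun y => deriv (fun z => (A t z) ^ 3) y) = fun y =>
          fderiv ℝ (fun p : ℝ × ℝ => (Function.uncurry A p) ^ 3) (t, y) (0, 1) := by
        funext y
        exact (hCx t y).deriv
      rw [this]
      exact (contDiff_dir_aux _ hC (0, 1)).continuous.comp
        (continuous_const.prodMk continuous_id)
    have hnot : ∀ x, ¬ IntegrableOn (fun y => deriv (fun z => (A t z) ^ 3) y) (Iic x) volume := by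
      intro x hx
      apply hx0
      have h2 : IntegrableOn (fun y => deriv (fun z => (A t z) ^ 3) y) (Icc x x0) volume :=
        hcont.continuousOn.integrableOn_Icc
      refine (hx.union h2).mono_set ?_
      intro y hy
      by_cases h : y ≤ x
      · exact Or.inl h
      · exact Or.inr ⟨(not_le.1 h).le, hy⟩
    have hz : ∀ x, fderiv ℝ (Function.uncurry I1) (t, x) (1, 0) = 0 := by
      intro x
      rw [← (hI1t t x).deriv]
      have h := hswap1 t x
      change deriv (fun s => I1 s x) t = _ at h
      rw [h]
      apply integral_undef
      intro hint
      apply hnot x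
      have h3 := hint.sub (hInt2 t x)
      refine h3.congr (Eventually.of_forall fun y => ?_)
      have h4 := hFirst t y
      simp only [Pi.sub_apply]
      linarith
    have hz2 : ∀ x, deriv (fun s => A s x) t = 0 := by
      intro x
      have h := hmix t x
      have e : (fun y => fderiv ℝ (Function.uncurry I1) (t, y) (1, 0)) = fun _ => (0 : ℝ) :=
        funext hz
      rw [e] at h
      exact h.unique (hasDerivAt_const x 0)
    apply hx0
    refine (hInt2 t x0).neg.congr (Eventually.of_forall fun y => ?_)
    have h4 := hFirst t y
    rw [hz2 y] at h4
    simp only [Pi.neg_apply]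
    linarith
  -- time derivative of `I1`
  have hI1t' : ∀ t x, deriv (fun s => I1 s x) t = I2 t x + (A t x) ^ 3 := by
    intro t x
    have h := hswap1 t x
    change deriv (fun s => I1 s x) t = _ at h
    rw [h]
    have e : (fun y => deriv (fun s => A s y) t)
        = fun y => I1 t y + deriv (fun z => (A t z) ^ 3) y := funext fun y => hFirst t y
    rw [e, integral_add (hInt2 t x) (hCi t x)]
    congr 1
    have hlim : Tendsto (fun y => (A t y) ^ 3) atBot (nhds 0) := by
      simpa using (hdecayA t).pow 3
    have := integral_Iic_of_hasDerivAt_of_tendsto' (a := x)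
      (fun y _ => (hCx t y).differentiableAt.hasDerivAt) (hCi t x) hlim
    simpa using this
  have hI2d : ∀ t x, DifferentiableAt ℝ (fun s => I2 s x) t := by
    intro t x
    have e : (fun s => I2 s x) = fun s =>
        fderiv ℝ (Function.uncurry I1) (s, x) (1, 0) - (A s x) ^ 3 := by
      funext s
      have h := hI1t' s x
      rw [(hI1t s x).deriv] at h
      linarith
    rw [e]
    exact (hasDerivAt_fst_aux _ ((contDiff_dir_aux _ hI1s (1, 0)).differentiable
      (by simp)) t x).differentiableAt.sub ((hAt t x).differentiableAt.pow 3)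
  intro τ ξ
  have hB : (fun t : ℝ => deriv (fun x : ℝ => (∫ a in Iic x, I2 t a)
      + ∫ a in Iic x, (A t a) ^ 3) ξ) = fun t => I2 t ξ + (A t ξ) ^ 3 := by
    funext t
    exact ((hI3x t ξ).add (hI4x t ξ)).deriv
  change deriv (fun t : ℝ => deriv (fun x : ℝ => (∫ a in Iic x, I2 t a)
      + ∫ a in Iic x, (A t a) ^ 3) ξ) τ = ((∫ a in Iic ξ, I2 τ a)
      + ∫ a in Iic ξ, (A τ a) ^ 3) + 3 * (A τ ξ) ^ 2 * I1 τ ξ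
      + 9 * (A τ ξ) ^ 4 * deriv (fun x : ℝ => A τ x) ξ
  rw [hB]
  have hs3 : deriv (fun t => I2 t ξ) τ = (∫ a in Iic ξ, I2 τ a) + ∫ a in Iic ξ, (A τ a) ^ 3 := by
    have h := hswap3 τ ξ
    change deriv (fun t => I2 t ξ) τ = ∫ x in Iic ξ, deriv (fun t => I1 t x) τ at h
    rw [h]
    simp only [hI1t']
    exact integral_add (hInt3 τ ξ) (hInt4 τ ξ)
  have hsum := ((hI2d τ ξ).hasDerivAt.add ((hAt τ ξ).differentiableAt.hasDerivAt.pow 3)).deriv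
  have hF := hFirst τ ξ
  change _ = I1 τ ξ + _ at hF
  have hcube := ((hAx τ ξ).differentiableAt.hasDerivAt.pow 3).deriv
  change deriv (fun x => (A τ x) ^ 3) ξ = _ at hcube
  change deriv (fun t => I2 t ξ + (A t ξ) ^ 3) τ = _ at hsum
  rw [hsum, hs3, hF, hcube]
  norm_num
  ring
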